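/- Let A be an m-homogeneous supersolvable line arrangement in ℙ² with m ≥ 3. Then the number M of modular points of A satisfies M ≤ 4. -/

import Mathlib

open scoped LinearAlgebra.Projectivization

noncomputable section

attribute [local instance] Classical.propDecidable

/-- A point of the complex projective plane. -/
abbrev ProjPoint := ℙ ℂ (Fin 3 → ℂ)

/-- A line of the complex projective plane, encoded by a defining linear form
up to scalar, i.e. as a point of the dual projective plane. -/
abbrev ProjLine := ℙ ℂ (Module.Dual ℂ (Fin 3 → ℂ))

/-- The incidence relation between points and lines of `ℙ²`. -/
def PointOnLine (p : ProjPoint) (L : ProjLine) : Prop :=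
  L.rep p.rep = 0

/-- The multiplicity of a point with respect to a line arrangement:
the number of lines of the arrangement passing through the point. -/
def mult (A : Finset ProjLine) (p : ProjPoint) : ℕ :=
  Set.ncard {L : ProjLine | L ∈ A ∧ PointOnLine p L}

/-- An intersection point of a line arrangement: a point lying on at least two lines. -/
def IsIntersectionPoint (A : Finset ProjLine) (p : ProjPoint) : Prop :=
  2 ≤ mult A p

/-- A modular point: an intersection point `p` such that for any other intersection
point `q`, the line through `p` and `q` belongs to the arrangement. -/
def IsModular (A : Finset ProjLine) (p : ProjPoint) : Prop :=
  IsIntersectionPoint A p ∧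
    ∀ q : ProjPoint, IsIntersectionPoint A q → q ≠ p →
      ∃ L ∈ A, PointOnLine p L ∧ PointOnLine q L

/-- A supersolvable line arrangement: one possessing a modular point. -/
def IsSupersolvable (A : Finset ProjLine) : Prop :=
  ∃ p, IsModular A p

/-- An `m`-homogeneous supersolvable line arrangement: supersolvable, and all
modular points have multiplicity `m`. -/
def IsHomogSS (A : Finset ProjLine) (m : ℕ) : Prop :=
  IsSupersolvable A ∧ ∀ p, IsModular A p → mult A p = m

/-- `nk A k` is the number of intersection points of multiplicity `k` of `A`. -/
def nk (A : Finset ProjLine) (k : ℕ) : ℕ :=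
  Set.ncard {p : ProjPoint | IsIntersectionPoint A p ∧ mult A p = k}

/-- A pencil: all lines pass through a common point. -/
def IsPencil (A : Finset ProjLine) : Prop :=
  ∃ p, ∀ L ∈ A, PointOnLine p L

lemma pol_mk (x : Fin 3 → ℂ) (hx : x ≠ 0) (L : ProjLine) :
    PointOnLine (Projectivization.mk ℂ x hx) L ↔ L.rep x = 0 := by
  unfold PointOnLine
  obtain ⟨a, ha⟩ := Projectivization.exists_smul_eq_mk_rep ℂ x hx
  rw [← ha, Units.smul_def, map_smul, smul_eq_mul]
  simp

lemma line_eq_of_smul (L L' : ProjLine) (c : ℂ) (h : L'.rep = c • L.rep) : L' = L := by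
  rw [← L.mk_rep, ← L'.mk_rep, Projectivization.mk_eq_mk_iff']
  exact ⟨c, h.symm⟩

lemma exists_third (p q : ProjPoint) (hpq : p ≠ q) :
    ∃ w : Fin 3 → ℂ, LinearIndependent ℂ ![p.rep, q.rep, w] := by
  have h := (Projectivization.linearIndependent_pair_iff_ne (K := ℂ)).2 hpq
  obtain ⟨w, hw⟩ := exists_linearIndependent_snoc_of_lt_finrank (R := ℂ) h (by simp)
  refine ⟨w, ?_⟩
  have e : ![p.rep, q.rep, w] = Fin.snoc (α := fun _ => Fin 3 → ℂ) ![p.rep, q.rep] w := by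
    ext i j
    fin_cases i <;> rfl
  rw [e]
  exact hw

lemma dual_ext {u v w : Fin 3 → ℂ} (h : LinearIndependent ℂ ![u, v, w])
    (f g : Module.Dual ℂ (Fin 3 → ℂ)) (hu : f u = g u) (hv : f v = g v) (hw : f w = g w) :
    f = g := by
  have hc : Fintype.card (Fin 3) = Module.finrank ℂ (Fin 3 → ℂ) := by simp
  refine (basisOfLinearIndependentOfCardEqFinrank h hc).ext fun i => ?_
  rw [coe_basisOfLinearIndependentOfCardEqFinrank]
  fin_cases i
  · exact hu
  · exact hv
  · exact hw

lemma comb_ne {u v w : Fin 3 → ℂ} (h : LinearIndependent ℂ ![u, v, w])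
    (s t z : ℂ) (hz : z ≠ 0) : s • u + t • v + z • w ≠ 0 := by
  intro h0
  have := Fintype.linearIndependent_iff.1 h ![s, t, z] (by simpa [Fin.sum_univ_three] using h0) 2
  exact hz (by simpa using this)

lemma line_unique {p q : ProjPoint} (hpq : p ≠ q) {L L' : ProjLine}
    (h1 : PointOnLine p L) (h2 : PointOnLine q L) (h3 : PointOnLine p L')
    (h4 : PointOnLine q L') : L' = L := by
  obtain ⟨w, hw⟩ := exists_third p q hpq
  unfold PointOnLine at *
  have hne : L.rep w ≠ 0 := fun h0 =>
    L.rep_nonzero (dual_ext hw _ 0 (by simpa using h1) (by simpa using h2) (by simpa using h0))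
  refine line_eq_of_smul L L' (L'.rep w / L.rep w) (dual_ext hw _ _ ?_ ?_ ?_)
  · simp [h1, h3]
  · simp [h2, h4]
  · simp [hne]

lemma mult_eq (A : Finset ProjLine) (p : ProjPoint) :
    mult A p = (A.filter (fun L => PointOnLine p L)).card := by
  unfold mult
  rw [← Set.ncard_coe_finset]
  congr 1
  ext L
  simp

lemma isInt_of {A : Finset ProjLine} {p : ProjPoint} {L L' : ProjLine} (hL : L ∈ A)
    (hL' : L' ∈ A) (hne : L ≠ L') (h : PointOnLine p L) (h' : PointOnLine p L') :
    IsIntersectionPoint A p := by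
  unfold IsIntersectionPoint
  rw [mult_eq]
  exact Finset.one_lt_card.2 ⟨L, by simp [hL, h], L', by simp [hL', h'], hne⟩

/-- All lines missing two modular points of equal multiplicity are concurrent
(they pass through the centroid of the grid). -/
lemma exists_center (A : Finset ProjLine) (p q : ProjPoint) (hpq : p ≠ q)
    (hp : IsModular A p) (hm : mult A p = mult A q) :
    ∃ O : ProjPoint, (∀ L : ProjLine, PointOnLine p L → PointOnLine q L → ¬ PointOnLine O L) ∧
      ∀ L ∈ A, PointOnLine p L ∨ PointOnLine q L ∨ PointOnLine O L := by
  obtain ⟨w, hw⟩ := exists_third p q hpq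
  set u := p.rep with hu
  set v := q.rep with hv
  set P := A.filter (fun L => PointOnLine p L ∧ ¬ PointOnLine q L) with hP
  set Q := A.filter (fun L => PointOnLine q L ∧ ¬ PointOnLine p L) with hQ
  have hp2 : 2 ≤ mult A p := hp.1
  rw [mult_eq] at hp2
  rw [mult_eq, mult_eq] at hm
  have e1 := Finset.card_filter_add_card_filter_not (s := A.filter (fun L => PointOnLine p L))
    (fun L => PointOnLine q L)
  have e2 := Finset.card_filter_add_card_filter_not (s := A.filter (fun L => PointOnLine q L))
    (fun L => PointOnLine p L)
  rw [Finset.filter_filter, Finset.filter_filter] at e1 e2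
  have e3 : (A.filter (fun L => PointOnLine p L ∧ PointOnLine q L)) =
      (A.filter (fun L => PointOnLine q L ∧ PointOnLine p L)) := by
    ext L; simp [and_comm]
  have e4 : (A.filter (fun L => PointOnLine p L ∧ PointOnLine q L)).card ≤ 1 := by
    refine Finset.card_le_one.2 fun a ha b hb => ?_
    simp only [Finset.mem_filter] at ha hb
    exact line_unique hpq hb.2.1 hb.2.2 ha.2.1 ha.2.2
  rw [← e3] at e2
  have e5 : (A.filter (fun L => PointOnLine p L ∧ PointOnLine q L)).card + P.card =
      (A.filter (fun L => PointOnLine p L)).card := by convert e1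
  have e6 : (A.filter (fun L => PointOnLine p L ∧ PointOnLine q L)).card + Q.card =
      (A.filter (fun L => PointOnLine q L)).card := by convert e2
  have hPQ : P.card = Q.card := by omega
  have hQ0 : Q.card ≠ 0 := by omega
  set S := Q.image (fun L => - L.rep w / L.rep u) with hS
  set T := P.image (fun L => - L.rep w / L.rep v) with hT
  have cS : S.card = Q.card := by
    refine Finset.card_image_of_injOn fun a ha b hb hab => ?_
    simp only [hQ, Finset.coe_filter, Set.mem_ofPred_eq, PointOnLine, ← hu, ← hv] at ha hb
    refine line_eq_of_smul _ _ (a.rep u / b.rep u) (dual_ext hw _ _ ?_ ?_ ?_)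
    · simp [hb.2.2]
    · simp [hb.2.1, ha.2.1]
    · have h1 := ha.2.2
      have h2 := hb.2.2
      simp only [LinearMap.smul_apply, smul_eq_mul]
      field_simp at hab ⊢
      linear_combination -hab
  have cT : T.card = P.card := by
    refine Finset.card_image_of_injOn fun a ha b hb hab => ?_
    simp only [hP, Finset.coe_filter, Set.mem_ofPred_eq, PointOnLine, ← hu, ← hv] at ha hb
    refine line_eq_of_smul _ _ (a.rep v / b.rep v) (dual_ext hw _ _ ?_ ?_ ?_)
    · simp [hb.2.1, ha.2.1]
    · simp [hb.2.2]
    · have h1 := ha.2.2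
      have h2 := hb.2.2
      simp only [LinearMap.smul_apply, smul_eq_mul]
      field_simp at hab ⊢
      linear_combination -hab
  have hn0 : (S.card : ℂ) ≠ 0 := by rw [cS]; exact_mod_cast hQ0
  refine ⟨Projectivization.mk ℂ _ (comb_ne hw (∑ s ∈ S, s) (∑ t ∈ T, t) S.card hn0), ?_, ?_⟩
  · intro L h1 h2 h3
    rw [pol_mk] at h3
    unfold PointOnLine at h1 h2
    rw [← hu] at h1
    rw [← hv] at h2
    simp only [map_add, map_smul, h1, h2, smul_eq_mul, mul_zero, zero_add, mul_eq_zero, hn0,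
      false_or] at h3
    exact L.rep_nonzero (dual_ext hw _ 0 (by simpa using h1) (by simpa using h2)
      (by simpa using h3))
  · intro L hL
    by_cases h1 : PointOnLine p L
    · exact Or.inl h1
    by_cases h2 : PointOnLine q L
    · exact Or.inr (Or.inl h2)
    refine Or.inr (Or.inr ?_)
    rw [pol_mk]
    have h1' : L.rep u ≠ 0 := h1
    have h2' : L.rep v ≠ 0 := h2
    set φ : ℂ → ℂ := fun s => -(s * L.rep u + L.rep w) / L.rep v with hφ
    have φinj : Function.Injective φ := by
      intro a b hab
      simp only [hφ] at hab
      field_simp at hab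
      have : (a - b) * L.rep u = 0 := by linear_combination -hab
      simpa [h1', sub_eq_zero] using this
    have hsub : S.image φ ⊆ T := by
      intro t ht
      simp only [hS, Finset.mem_image, hQ, Finset.mem_filter] at ht
      obtain ⟨s, ⟨K, ⟨hK, hKq, hKp⟩, rfl⟩, rfl⟩ := ht
      set s := -K.rep w / K.rep u with hs
      have hKu : K.rep u ≠ 0 := hKp
      have hKv : K.rep v = 0 := hKq
      have hx := comb_ne hw s (φ s) 1 one_ne_zero
      have xK : PointOnLine (Projectivization.mk ℂ _ hx) K := by
        rw [pol_mk]
        simp only [map_add, map_smul, smul_eq_mul, hKv, hs]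
        field_simp
        ring
      have xL : PointOnLine (Projectivization.mk ℂ _ hx) L := by
        rw [pol_mk]
        simp only [map_add, map_smul, smul_eq_mul, hφ]
        field_simp
        ring
      have hKL : K ≠ L := fun h => h2 (h ▸ hKq)
      have hint := isInt_of hK hL hKL xK xL
      have hxp : Projectivization.mk ℂ _ hx ≠ p := by
        intro h
        obtain ⟨w', hw'⟩ := Projectivization.exists_smul_eq_mk_rep ℂ _ hx
        rw [h, ← hu] at hw'
        have := comb_ne hw ((w' : ℂ) * s - 1) ((w' : ℂ) * φ s) (w' : ℂ) w'.ne_zero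
        apply this
        rw [Units.smul_def] at hw'
        calc _ = (w' : ℂ) • (s • u + φ s • v + (1 : ℂ) • w) - u := by module
          _ = 0 := by rw [hw', sub_self]
      obtain ⟨N, hN, hNp, hNx⟩ := hp.2 _ hint hxp
      rw [pol_mk] at hNx
      have hNu : N.rep u = 0 := hNp
      simp only [map_add, map_smul, smul_eq_mul, hNu, mul_zero, zero_add, one_mul] at hNx
      have hNv : N.rep v ≠ 0 := by
        intro h0
        rw [h0, mul_zero, zero_add] at hNx
        exact N.rep_nonzero (dual_ext hw _ 0 (by simpa using hNu) (by simpa using h0)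
          (by simpa using hNx))
      rw [hT, Finset.mem_image]
      refine ⟨N, ?_, ?_⟩
      · simp only [hP, Finset.mem_filter]
        exact ⟨hN, hNp, hNv⟩
      · rw [div_eq_iff hNv]
        linear_combination -hNx
    have himg : S.image φ = T := by
      apply Finset.eq_of_subset_of_card_le hsub
      rw [Finset.card_image_of_injective _ φinj]
      omega
    have hsum : ∑ t ∈ T, t = ∑ s ∈ S, φ s := by
      rw [← himg, Finset.sum_image (fun a _ b _ h => φinj h)]
    have hsum2 : (∑ t ∈ T, t) * L.rep v = -((∑ s ∈ S, s) * L.rep u + S.card * L.rep w) := by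
      rw [hsum, Finset.sum_mul, Finset.sum_mul]
      have : ∀ s ∈ S, φ s * L.rep v = -(s * L.rep u + L.rep w) := by
        intro s _
        simp only [hφ]
        field_simp
      rw [Finset.sum_congr rfl this, Finset.sum_neg_distrib, Finset.sum_add_distrib]
      simp
    simp only [map_add, map_smul, smul_eq_mul]
    linear_combination hsum2

/-- No three distinct modular points are collinear. -/
lemma not_collinear (A : Finset ProjLine) (m : ℕ) (hm : 3 ≤ m)
    (h : ∀ p, IsModular A p → mult A p = m) {p q r : ProjPoint} (hp : IsModular A p)
    (hq : IsModular A q) (hr : IsModular A r) (hpq : p ≠ q) (hpr : p ≠ r) (hqr : q ≠ r)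
    (L : ProjLine) (h1 : PointOnLine p L) (h2 : PointOnLine q L) (h3 : PointOnLine r L) :
    False := by
  obtain ⟨O, hO, hA⟩ := exists_center A p q hpq hp ((h p hp).trans (h q hq).symm)
  have hrm := h r hr
  rw [mult_eq] at hrm
  have hc := Finset.pred_card_le_card_erase (s := A.filter (fun L => PointOnLine r L)) (a := L)
  obtain ⟨a, ha, b, hb, hab⟩ := Finset.one_lt_card.1
    (show 1 < ((A.filter (fun L => PointOnLine r L)).erase L).card by omega)
  simp only [Finset.mem_erase, Finset.mem_filter] at ha hb
  have key : ∀ a, a ≠ L → a ∈ A → PointOnLine r a → PointOnLine O a := by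
    intro a haL haA har
    rcases hA a haA with h4 | h4 | h4
    · exact absurd (line_unique hpr h1 h3 h4 har) haL
    · exact absurd (line_unique hqr h2 h3 h4 har) haL
    · exact h4
  have hrO : r ≠ O := by
    rintro rfl
    exact hO L h1 h2 h3
  exact hab (line_unique hrO hb.2.2 (key b hb.1 hb.2.1 hb.2.2) ha.2.2
    (key a ha.1 ha.2.1 ha.2.2))

/-- If `m ≥ 4`, a third modular point is the center. -/
lemma eq_center (A : Finset ProjLine) (p q r O : ProjPoint) (hm : 4 ≤ mult A r)
    (hpr : p ≠ r) (hqr : q ≠ r)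
    (hA : ∀ L ∈ A, PointOnLine p L ∨ PointOnLine q L ∨ PointOnLine O L) : r = O := by
  by_contra hrO
  rw [mult_eq] at hm
  have hsub : A.filter (fun L => PointOnLine r L) ⊆
      A.filter (fun L => PointOnLine p L ∧ PointOnLine r L) ∪
      (A.filter (fun L => PointOnLine q L ∧ PointOnLine r L) ∪
       A.filter (fun L => PointOnLine O L ∧ PointOnLine r L)) := by
    intro L hL
    simp only [Finset.mem_filter, Finset.mem_union] at hL ⊢
    have := hA L hL.1
    tauto
  have one : ∀ x : ProjPoint, x ≠ r →
      (A.filter (fun L => PointOnLine x L ∧ PointOnLine r L)).card ≤ 1 := by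
    intro x hx
    refine Finset.card_le_one.2 fun a ha b hb => ?_
    simp only [Finset.mem_filter] at ha hb
    exact line_unique hx hb.2.1 hb.2.2 ha.2.1 ha.2.2
  have c1 := Finset.card_le_card hsub
  have c2 := Finset.card_union_le (A.filter (fun L => PointOnLine p L ∧ PointOnLine r L))
      (A.filter (fun L => PointOnLine q L ∧ PointOnLine r L) ∪
       A.filter (fun L => PointOnLine O L ∧ PointOnLine r L))
  have c3 := Finset.card_union_le (A.filter (fun L => PointOnLine q L ∧ PointOnLine r L))
       (A.filter (fun L => PointOnLine O L ∧ PointOnLine r L))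
  have := one p hpr
  have := one q hqr
  have := one O (Ne.symm hrO)
  omega

/-- An `m`-homogeneous supersolvable line arrangement with `m ≥ 3`
has at most `4` modular points. -/
theorem modular_points_le_four (A : Finset ProjLine) (m : ℕ) (hm : 3 ≤ m)
    (h : IsHomogSS A m) :
    {p : ProjPoint | IsModular A p}.ncard ≤ 4 := by
  by_contra hcon
  push Not at hcon
  obtain ⟨-, h⟩ := h
  have hfin : {p : ProjPoint | IsModular A p}.Finite :=
    Set.finite_of_ncard_ne_zero (by omega)
  set M := hfin.toFinset with hMdef
  have hmem : ∀ x, x ∈ M ↔ IsModular A x := by intro x; simp [hMdef]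
  rw [Set.ncard_eq_toFinset_card _ hfin, ← hMdef] at hcon
  obtain ⟨p, hp, q, hq, hpq⟩ := Finset.one_lt_card.1 (show 1 < M.card by omega)
  set R := (M.erase p).erase q with hR
  have hRc : 3 ≤ R.card := by
    have := Finset.pred_card_le_card_erase (s := M) (a := p)
    have : (M.erase p).card - 1 ≤ R.card := Finset.pred_card_le_card_erase
    omega
  have hRm : ∀ r ∈ R, IsModular A r ∧ p ≠ r ∧ q ≠ r := by
    intro r hr
    simp only [hR, Finset.mem_erase, hmem] at hr
    exact ⟨hr.2.2, Ne.symm hr.2.1, Ne.symm hr.1⟩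
  rw [hmem] at hp hq
  by_cases hm4 : 4 ≤ m
  · obtain ⟨O, hO, hA⟩ := exists_center A p q hpq hp ((h p hp).trans (h q hq).symm)
    obtain ⟨a, ha, b, hb, hab⟩ := Finset.one_lt_card.1 (show 1 < R.card by omega)
    have ha' := hRm a ha
    have hb' := hRm b hb
    have e1 := eq_center A p q a O (by rw [h a ha'.1]; exact hm4) ha'.2.1 ha'.2.2 hA
    have e2 := eq_center A p q b O (by rw [h b hb'.1]; exact hm4) hb'.2.1 hb'.2.2 hA
    exact hab (e1.trans e2.symm)
  · have hmp := h p hp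
    rw [mult_eq] at hmp
    obtain ⟨L, hLA, hLp, hLq⟩ := hp.2 q hq.1 hpq.symm
    have hex : ∀ r, ∃ K, r ∈ R → K ∈ A ∧ PointOnLine p K ∧ PointOnLine r K := by
      intro r
      by_cases hr : r ∈ R
      · obtain ⟨h1, h2, -⟩ := hRm r hr
        obtain ⟨K, h3, h4, h5⟩ := hp.2 r h1.1 (Ne.symm h2)
        exact ⟨K, fun _ => ⟨h3, h4, h5⟩⟩
      · exact ⟨L, fun h => absurd h hr⟩
    choose f hf using hex
    have hcard : R.card ≤ ((A.filter (fun L => PointOnLine p L)).erase L).card := by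
      refine Finset.card_le_card_of_injOn f ?_ ?_
      · intro r hr
        have hr' : r ∈ R := hr
        obtain ⟨h1, h2, h3⟩ := hf r hr'
        obtain ⟨h4, h5, h6⟩ := hRm r hr'
        simp only [Finset.coe_erase, Finset.coe_filter, Set.mem_sdiff, Set.mem_ofPred_eq,
          Set.mem_singleton_iff]
        refine ⟨⟨h1, h2⟩, fun hL => ?_⟩
        rw [hL] at h3
        exact not_collinear A m hm h hp hq h4 hpq h5 h6 L hLp hLq h3
      · intro r hr s hs hrs
        by_contra hne
        obtain ⟨-, h2, h3⟩ := hf r hr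
        obtain ⟨-, -, h3'⟩ := hf s hs
        obtain ⟨h4, h5, -⟩ := hRm r hr
        obtain ⟨h4', h5', -⟩ := hRm s hs
        rw [← hrs] at h3'
        exact not_collinear A m hm h hp h4 h4' h5 h5' hne _ h2 h3 h3'
    have hmemL : L ∈ A.filter (fun L => PointOnLine p L) := by simp [hLA, hLp]
    rw [Finset.card_erase_of_mem hmemL, hmp] at hcard
    omega

end
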